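/- arXiv:2103.06651 — 4 statements merged into one kernel-verified Lean document; each statement's English description precedes it below -/
import Mathlib

section
/- Let A⁺ and A⁻ be n×m matrices with entries in {0,1} such that every column of A⁺ contains exactly one entry equal to 1, every column of A⁻ contains exactly one entry equal to 1, and for every column index j the row index of the 1 in column j of A⁺ is different from the row index of the 1 in column j of A⁻. Then the m×m matrix B = (A⁻)ᵀ A⁺ has all entries in {0,1}, all diagonal entries of B are 0, any two rows of B are equal or orthogonal, and any two columns of B are equal or orthogonal. -/
open Matrix BigOperators

/-- If `Ap` and `Am` are the incoming and outgoing incidence matrices of a multi digraph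
without loops (binary matrices, each column containing exactly one `1`, with the `1`s in
corresponding columns in different rows), then `B = Amᵀ * Ap` is binary, has zero
diagonal, and any two of its rows (resp. columns) are equal or orthogonal. -/
theorem line_digraph_adjacency_necessity (n m : ℕ)
    (Ap Am : Matrix (Fin n) (Fin m) ℝ)
    (hAp01 : ∀ i j, Ap i j = 0 ∨ Ap i j = 1)
    (hAm01 : ∀ i j, Am i j = 0 ∨ Am i j = 1)
    (hApcol : ∀ j, ∃! i, Ap i j = 1)
    (hAmcol : ∀ j, ∃! i, Am i j = 1)
    (hdiff : ∀ j i, ¬(Ap i j = 1 ∧ Am i j = 1))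
    (B : Matrix (Fin m) (Fin m) ℝ) (hB : B = Amᵀ * Ap) :
    (∀ i j, B i j = 0 ∨ B i j = 1) ∧
    (∀ i, B i i = 0) ∧
    (∀ i i', (∀ j, B i j = B i' j) ∨ (∑ j, B i j * B i' j) = 0) ∧
    (∀ j j', (∀ i, B i j = B i j') ∨ (∑ i, B i j * B i j') = 0) := by
  choose h hh hu using hApcol
  choose t ht tu using hAmcol
  have hA : ∀ i j, Ap i j = if i = h j then 1 else 0 := by
    intro i j
    split_ifs with e
    · rw [e]; exact hh j
    · rcases hAp01 i j with h0 | h1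
      · exact h0
      · exact absurd (hu j i h1) e
  have hM : ∀ i j, Am i j = if i = t j then 1 else 0 := by
    intro i j
    split_ifs with e
    · rw [e]; exact ht j
    · rcases hAm01 i j with h0 | h1
      · exact h0
      · exact absurd (tu j i h1) e
  have hBe : ∀ i j, B i j = if t i = h j then 1 else 0 := by
    intro i j
    rw [hB, Matrix.mul_apply]
    simp [hA, hM, eq_comm]
  have hne : ∀ i, t i ≠ h i := by
    intro i e
    exact hdiff i (h i) ⟨hh i, e ▸ ht i⟩
  refine ⟨?_, ?_, ?_, ?_⟩
  · intro i j
    rw [hBe]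
    split_ifs <;> simp
  · intro i
    rw [hBe, if_neg (hne i)]
  · intro i i'
    by_cases e : t i = t i'
    · left
      intro j
      rw [hBe, hBe, e]
    · right
      apply Finset.sum_eq_zero
      intro j _
      rw [hBe, hBe]
      by_cases e1 : t i = h j
      · rw [if_neg (fun e2 : t i' = h j => e (e1.trans e2.symm)), mul_zero]
      · rw [if_neg e1, zero_mul]
  · intro j j'
    by_cases e : h j = h j'
    · left
      intro i
      rw [hBe, hBe, e]
    · right
      apply Finset.sum_eq_zero
      intro i _
      rw [hBe, hBe]
      by_cases e1 : t i = h j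
      · rw [if_neg (fun e2 : t i = h j' => e (e1.symm.trans e2)), mul_zero]
      · rw [if_neg e1, zero_mul]
end

section
/- Let A be an m×m matrix with entries in {0,1} such that all diagonal entries of A are 0, any two rows of A are equal or orthogonal, and any two columns of A are equal or orthogonal. Then there exist a natural number n and n×m matrices A⁺ and A⁻ with entries in {0,1}, each column of A⁺ containing exactly one 1 and each column of A⁻ containing exactly one 1, such that for every column index j the row index of the 1 in column j of A⁺ differs from the row index of the 1 in column j of A⁻, and A = (A⁻)ᵀ A⁺. -/
open Matrix BigOperators

/-- A binary matrix with zero diagonal whose rows are pairwise equal or orthogonal and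
whose columns are pairwise equal or orthogonal is the adjacency matrix of the line
digraph of a multi digraph without loops: it factors as `A = Amᵀ * Ap` through incoming
and outgoing incidence matrices `Ap`, `Am`. -/
theorem line_digraph_adjacency_sufficiency (m : ℕ)
    (A : Matrix (Fin m) (Fin m) ℝ)
    (h01 : ∀ i j, A i j = 0 ∨ A i j = 1)
    (hdiag : ∀ i, A i i = 0)
    (hrows : ∀ i i', (∀ j, A i j = A i' j) ∨ (∑ j, A i j * A i' j) = 0)
    (hcols : ∀ j j', (∀ i, A i j = A i j') ∨ (∑ i, A i j * A i j') = 0) :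
    ∃ (n : ℕ) (Ap Am : Matrix (Fin n) (Fin m) ℝ),
      (∀ i j, Ap i j = 0 ∨ Ap i j = 1) ∧
      (∀ i j, Am i j = 0 ∨ Am i j = 1) ∧
      (∀ j, ∃! i, Ap i j = 1) ∧
      (∀ j, ∃! i, Am i j = 1) ∧
      (∀ j i, ¬(Ap i j = 1 ∧ Am i j = 1)) ∧
      A = Amᵀ * Ap := by
  classical
  -- two rows sharing a common 1 coincide
  have key : ∀ i i' j, A i j = 1 → A i' j = 1 → ∀ k, A i k = A i' k := by
    intro i i' j h h'
    rcases hrows i i' with e | e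
    · exact e
    · exfalso
      have hnn : ∀ k ∈ Finset.univ, 0 ≤ A i k * A i' k := by
        intro k _
        rcases h01 i k with a | a <;> rcases h01 i' k with b | b <;> simp [a, b]
      have := (Finset.sum_eq_zero_iff_of_nonneg hnn).1 e j (Finset.mem_univ j)
      simp [h, h'] at this
  let e := Fintype.equivFin (Option (Set (Fin m)))
  let q : Fin m → Option (Set (Fin m)) := fun i => some {k | A i k = 1}
  let p : Fin m → Option (Set (Fin m)) := fun j =>
    if h : ∃ i, A i j = 1 then some {k | A h.choose k = 1} else none
  have hpq : ∀ i j, A i j = 1 ↔ p j = q i := by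
    intro i j
    by_cases h : ∃ i, A i j = 1
    · have hp : p j = some {k | A h.choose k = 1} := dif_pos h
      rw [hp]
      constructor
      · intro hij
        have := key _ _ j h.choose_spec hij
        simp [q, this]
      · intro hs
        have hs' : {k | A h.choose k = 1} = {k | A i k = 1} := Option.some.inj hs
        have hm : j ∈ {k | A h.choose k = 1} := h.choose_spec
        rw [hs'] at hm
        exact hm
    · have hp : p j = none := dif_neg h
      rw [hp]
      constructor
      · intro hij
        exact absurd ⟨i, hij⟩ h
      · intro hs
        simp [q] at hs
  refine ⟨_, Matrix.of fun v j => if v = e (p j) then 1 else 0,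
    Matrix.of fun v j => if v = e (q j) then 1 else 0,
    ?_, ?_, ?_, ?_, ?_, ?_⟩
  · intro i j
    by_cases h : i = e (p j) <;> simp [h]
  · intro i j
    by_cases h : i = e (q j) <;> simp [h]
  · intro j
    exact ⟨e (p j), by simp, fun y hy => by simpa using hy⟩
  · intro j
    exact ⟨e (q j), by simp, fun y hy => by simpa using hy⟩
  · rintro j i ⟨h1, h2⟩
    have h1' : i = e (p j) := by simpa using h1
    have h2' : i = e (q j) := by simpa using h2
    have := (hpq j j).2 (e.injective (h1'.symm.trans h2'))
    rw [hdiag] at this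
    exact zero_ne_one this
  · ext i j
    have : (∑ v, (if v = e (q i) then (1:ℝ) else 0) * (if v = e (p j) then 1 else 0))
        = if p j = q i then 1 else 0 := by
      simp [eq_comm]
    rw [Matrix.mul_apply]
    simp only [Matrix.transpose_apply, Matrix.of_apply]
    refine Eq.trans ?_ this.symm
    by_cases h : p j = q i
    · rw [if_pos h, (hpq i j).2 h]
    · rw [if_neg h]
      exact (h01 i j).resolve_right fun h' => h ((hpq i j).1 h')
end

section
/- Let Ξ_out and Ξ_in be real 2m×2m matrices and set A = hat((hat(Ξ_out))ᵀ · hat(Ξ_in)). Assume: (i) no column and no row of Ξ_out is zero; (ii) all diagonal entries of A are 0, any two rows of A are equal or orthogonal, and any two columns of A are equal or orthogonal; (iii) letting I = {i : row i of Ξ_in is zero} and letting the equivalence classes of the relation 'rows of A are equal' on {1,…,2m} be denoted V_1, …, V_{M'} (with the class Z of indices of zero rows of A, if nonempty, among them), for every i ∈ I the support of row i of Ξ_out is contained in a single class V_j. Define 𝒱_S = {i ∈ {1,…,2m} : support of row i of Ξ_out ⊆ Z} and, for every class V consisting of indices of nonzero rows of A, define 𝒱_V = the union over s ∈ V of the supports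 of column s of Ξ_out. Then the sets 𝒱_V (over all such classes V) together with 𝒱_S are pairwise disjoint and their union is {1,…,2m}; moreover, for every column index j, if the support of column j of Ξ_out intersects one of these sets then it is contained in it, and for every column index k, if the support of column k of Ξ_in intersects one of these sets then it is contained in it. -/
open Matrix BigOperators

/-- `hat M` replaces every nonzero entry of `M` by `1` and every zero entry by `0`. -/
noncomputable def hat {k p : Type*} (M : Matrix k p ℝ) : Matrix k p ℝ :=
  Matrix.of fun i j => if M i j ≠ 0 then (1 : ℝ) else 0

/-- The set `𝒱_S` of row indices corresponding to sources: those `i` whose row of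
`Ξout` has support contained in the set `Z` of indices of zero rows of `A`. -/
def sourceRows {m : ℕ} (Ξout A : Matrix (Fin (2 * m)) (Fin (2 * m)) ℝ) :
    Set (Fin (2 * m)) :=
  {i | ∀ s, Ξout i s ≠ 0 → ∀ c, A s c = 0}

/-- The family of sets `𝒱_V = ⋃_{s ∈ V} supp (column s of Ξout)`, where `V` runs over
the equivalence classes of the relation "rows of `A` are equal" consisting of indices of
nonzero rows of `A` (each class is described by a representative `s0`). -/
def vertexRowFamily {m : ℕ} (Ξout A : Matrix (Fin (2 * m)) (Fin (2 * m)) ℝ) :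
    Set (Set (Fin (2 * m))) :=
  {W | ∃ s0, (∃ c, A s0 c ≠ 0) ∧
    W = {i | ∃ s, (∀ c, A s c = A s0 c) ∧ Ξout i s ≠ 0}}

/-- Under the assumptions of Proposition `admitg`: no zero row or column of `Ξout`, `A`
the adjacency matrix of a line digraph (zero diagonal, rows pairwise equal or
orthogonal, columns pairwise equal or orthogonal), and the support of every row of
`Ξout` indexed by a zero row of `Ξin` lying in a single row-equality class of `A` —
the sets `𝒱_V` together with `𝒱_S` partition the row indices, and every column of
`Ξout` (resp. `Ξin`) whose support meets one of these sets has its support contained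
in it. -/
theorem graph_reconstruction_partition (m : ℕ)
    (Ξout Ξin : Matrix (Fin (2 * m)) (Fin (2 * m)) ℝ)
    (hcol : ∀ j, ∃ i, Ξout i j ≠ 0)
    (hrow : ∀ i, ∃ j, Ξout i j ≠ 0)
    (A : Matrix (Fin (2 * m)) (Fin (2 * m)) ℝ)
    (hA : A = hat ((hat Ξout)ᵀ * hat Ξin))
    (hdiag : ∀ i, A i i = 0)
    (hrowsA : ∀ i i', (∀ j, A i j = A i' j) ∨ (∑ j, A i j * A i' j) = 0)
    (hcolsA : ∀ j j', (∀ i, A i j = A i j') ∨ (∑ i, A i j * A i j') = 0)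
    (hI : ∀ i, (∀ j, Ξin i j = 0) →
      ∀ s t, Ξout i s ≠ 0 → Ξout i t ≠ 0 → ∀ c, A s c = A t c) :
    (∀ W₁ ∈ insert (sourceRows Ξout A) (vertexRowFamily Ξout A),
      ∀ W₂ ∈ insert (sourceRows Ξout A) (vertexRowFamily Ξout A),
        W₁ ≠ W₂ → Disjoint W₁ W₂) ∧
    ⋃₀ insert (sourceRows Ξout A) (vertexRowFamily Ξout A) = Set.univ ∧
    (∀ W ∈ insert (sourceRows Ξout A) (vertexRowFamily Ξout A),
      ∀ j, (∃ i ∈ W, Ξout i j ≠ 0) → ∀ i, Ξout i j ≠ 0 → i ∈ W) ∧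
    (∀ W ∈ insert (sourceRows Ξout A) (vertexRowFamily Ξout A),
      ∀ k, (∃ i ∈ W, Ξin i k ≠ 0) → ∀ i, Ξin i k ≠ 0 → i ∈ W) := by
  have h01 : ∀ s c, 0 ≤ A s c := by
    intro s c
    rw [hA]
    generalize (hat Ξout)ᵀ * hat Ξin = B
    simp only [hat, Matrix.of_apply]
    split_ifs <;> norm_num
  have hpos : ∀ i s c, Ξout i s ≠ 0 → Ξin i c ≠ 0 → A s c ≠ 0 := by
    intro i s c h1 h2
    have h3 : 0 < ((hat Ξout)ᵀ * hat Ξin) s c := by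
      rw [Matrix.mul_apply]
      apply Finset.sum_pos'
      · intro x _
        simp only [hat, Matrix.of_apply, Matrix.transpose_apply]
        split_ifs <;> norm_num
      · refine ⟨i, Finset.mem_univ _, ?_⟩
        simp [hat, h1, h2]
    rw [hA]
    generalize (hat Ξout)ᵀ * hat Ξin = B at h3
    simp [hat, h3.ne']
  have key2 : ∀ s t c, A s c ≠ 0 → A t c ≠ 0 → ∀ d, A s d = A t d := by
    intro s t c h1 h2
    rcases hrowsA s t with h | h
    · exact h
    · exfalso
      rw [Finset.sum_eq_zero_iff_of_nonneg
        (fun x _ => mul_nonneg (h01 _ _) (h01 _ _))] at h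
      exact mul_ne_zero h1 h2 (h c (Finset.mem_univ _))
  have key : ∀ i s t, Ξout i s ≠ 0 → Ξout i t ≠ 0 → ∀ c, A s c = A t c := by
    intro i s t h1 h2
    by_cases h : ∀ j, Ξin i j = 0
    · exact hI i h s t h1 h2
    · push Not at h
      obtain ⟨k, hk⟩ := h
      exact key2 s t k (hpos i s k h1 hk) (hpos i t k h2 hk)
  refine ⟨?_, ?_, ?_, ?_⟩
  · have aux : ∀ W ∈ vertexRowFamily Ξout A, Disjoint (sourceRows Ξout A) W := by
      rintro W ⟨s0, ⟨c, hc⟩, rfl⟩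
      rw [Set.disjoint_left]
      rintro i hi ⟨s, hs, his⟩
      exact hc ((hs c).symm.trans (hi s his c))
    rintro W₁ (rfl | h₁) W₂ (rfl | h₂) hne
    · exact absurd rfl hne
    · exact aux _ h₂
    · exact (aux _ h₁).symm
    · obtain ⟨s1, -, rfl⟩ := h₁
      obtain ⟨s2, -, rfl⟩ := h₂
      rw [Set.disjoint_left]
      rintro i ⟨s, hs, his⟩ ⟨t, ht, hit⟩
      apply hne
      have : ∀ c, A s1 c = A s2 c := fun c =>
        (hs c).symm.trans ((key i s t his hit c).trans (ht c))
      simp only [this]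
  · rw [Set.eq_univ_iff_forall]
    intro i
    by_cases h : i ∈ sourceRows Ξout A
    · exact ⟨_, Or.inl rfl, h⟩
    · simp only [sourceRows, Set.mem_setOf_eq] at h
      push Not at h
      obtain ⟨s, hs, c, hc⟩ := h
      exact ⟨_, Or.inr ⟨s, ⟨c, hc⟩, rfl⟩, s, fun _ => rfl, hs⟩
  · rintro W (rfl | ⟨s0, -, rfl⟩) j ⟨i, hi, hij⟩ i' hi'
    · intro s hs c
      rw [key i' s j hs hi' c]
      exact hi j hij c
    · obtain ⟨s, hs, his⟩ := hi
      exact ⟨j, fun c => (key i j s hij his c).trans (hs c), hi'⟩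
  · rintro W (rfl | ⟨s0, -, rfl⟩) k ⟨i, hi, hik⟩ i' hi'
    · obtain ⟨s, hs⟩ := hrow i
      exact absurd (hi s hs k) (hpos i s k hs hik)
    · obtain ⟨s, hs, his⟩ := hi
      obtain ⟨t, ht⟩ := hrow i'
      exact ⟨t, fun c => (key2 t s k (hpos i' t k ht hi') (hpos i s k his hik) c).trans (hs c), ht⟩
end

section
/- Let Ξ_out and Ξ_in be real 2m×2m matrices satisfying: no column and no row of Ξ_out is zero; A = hat((hat(Ξ_out))ᵀ · hat(Ξ_in)) has zero diagonal, any two rows of A equal or orthogonal, and any two columns of A equal or orthogonal. Let V be an equivalence class of the relation 'rows of A are equal' consisting of indices of nonzero rows of A, and let W be an equivalence class of the relation 'columns of A are equal' consisting of indices of nonzero columns of A, such that A_{pq} = 1 for some p ∈ V and q ∈ W. Then (the union over s ∈ V of the supports of column s of Ξ_out) minus the set {r : row r of Ξ_in is zero} equals the union over q ∈ W of the supports of column q of Ξ_in. -/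
open Matrix BigOperators

/-- If `V` is a class of equal nonzero rows of `A` (represented by `s0`), `W` a class of
equal nonzero columns of `A` (represented by `q0`), and `A p q = 1` for some `p ∈ V`,
`q ∈ W`, then the union over `s ∈ V` of the supports of the columns `s` of `Ξout`, with
the indices of zero rows of `Ξin` removed, equals the union over `q ∈ W` of the supports
of the columns `q` of `Ξin`. -/
theorem vertex_out_in_rows_agree (m : ℕ)
    (Ξout Ξin : Matrix (Fin (2 * m)) (Fin (2 * m)) ℝ)
    (hcol : ∀ j, ∃ i, Ξout i j ≠ 0)
    (hrow : ∀ i, ∃ j, Ξout i j ≠ 0)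
    (A : Matrix (Fin (2 * m)) (Fin (2 * m)) ℝ)
    (hA : A = hat ((hat Ξout)ᵀ * hat Ξin))
    (hdiag : ∀ i, A i i = 0)
    (hrowsA : ∀ i i', (∀ j, A i j = A i' j) ∨ (∑ j, A i j * A i' j) = 0)
    (hcolsA : ∀ j j', (∀ i, A i j = A i j') ∨ (∑ i, A i j * A i j') = 0)
    (s0 q0 : Fin (2 * m))
    (hs0 : ∃ c, A s0 c ≠ 0)
    (hq0 : ∃ r, A r q0 ≠ 0)
    (hpq : ∃ p, (∀ c, A p c = A s0 c) ∧ ∃ q, (∀ r, A r q = A r q0) ∧ A p q = 1) :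
    {i | ∃ s, (∀ c, A s c = A s0 c) ∧ Ξout i s ≠ 0} \ {r | ∀ j, Ξin r j = 0}
      = {i | ∃ q, (∀ r, A r q = A r q0) ∧ Ξin i q ≠ 0} := by
  have h01 : ∀ s q, 0 ≤ A s q := by
    intro s q
    have h3 : A s q = if ((hat Ξout)ᵀ * hat Ξin) s q ≠ 0 then (1 : ℝ) else 0 := by
      rw [hA]; rfl
    rw [h3]
    by_cases h : ((hat Ξout)ᵀ * hat Ξin) s q ≠ 0
    · rw [if_pos h]; exact zero_le_one
    · rw [if_neg h]
  have hne : ∀ i s q, Ξout i s ≠ 0 → Ξin i q ≠ 0 → A s q ≠ 0 := by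
    intro i s q h1 h2
    have hpos : 0 < ((hat Ξout)ᵀ * hat Ξin) s q := by
      rw [Matrix.mul_apply]
      apply Finset.sum_pos'
      · intro k _
        simp only [hat, Matrix.transpose_apply, Matrix.of_apply]
        split_ifs <;> norm_num
      · refine ⟨i, Finset.mem_univ _, ?_⟩
        simp [hat, h1, h2]
    have h3 : A s q = if ((hat Ξout)ᵀ * hat Ξin) s q ≠ 0 then (1 : ℝ) else 0 := by
      rw [hA]; rfl
    rw [h3, if_pos hpos.ne']
    exact one_ne_zero
  have hrows : ∀ s s' q, A s q ≠ 0 → A s' q ≠ 0 → ∀ j, A s j = A s' j := by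
    intro s s' q h1 h2
    refine (hrowsA s s').resolve_right fun h => ?_
    rw [Finset.sum_eq_zero_iff_of_nonneg (fun j _ => mul_nonneg (h01 _ _) (h01 _ _))] at h
    exact mul_ne_zero h1 h2 (h q (Finset.mem_univ _))
  have hcols : ∀ s q q', A s q ≠ 0 → A s q' ≠ 0 → ∀ i, A i q = A i q' := by
    intro s q q' h1 h2
    refine (hcolsA q q').resolve_right fun h => ?_
    rw [Finset.sum_eq_zero_iff_of_nonneg (fun j _ => mul_nonneg (h01 _ _) (h01 _ _))] at h
    exact mul_ne_zero h1 h2 (h s (Finset.mem_univ _))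
  have h00 : A s0 q0 ≠ 0 := by
    obtain ⟨p, hp, q, hq, h⟩ := hpq
    rw [← hp, ← hq, h]
    exact one_ne_zero
  ext i
  simp only [Set.mem_diff, Set.mem_setOf_eq, not_forall]
  constructor
  · rintro ⟨⟨s, hs, hi⟩, j, hj⟩
    have h := hne i s j hi hj
    rw [hs] at h
    exact ⟨j, hcols s0 j q0 h h00, hj⟩
  · rintro ⟨q, hq, hi⟩
    obtain ⟨s, hs⟩ := hrow i
    have h := hne i s q hs hi
    rw [hq] at h
    exact ⟨⟨s, hrows s s0 q0 h h00, hs⟩, q, hi⟩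
end
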